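/- arXiv:1004.0033 — 3 statements merged into one kernel-verified Lean document; each statement's English description precedes it below -/
import Mathlib

section
/- Let s ≥ 1. There exist constants C₀, C₁ > 0 such that the following holds. Let A ∈ ℂ^{m×d} satisfy the restricted isometry property with parameters (3s, 0.2). Let x ∈ ℂ^d be arbitrary, let e ∈ ℂ^m satisfy ‖e‖₂ ≤ ε for some ε ≥ 0, and set y = Ax + e. Then any minimizer x⋆ of the Basis Pursuit problem min ‖z‖₁ subject to ‖Az − y‖₂ ≤ ε satisfies ‖x⋆ − x‖₂ ≤ C₀ ‖x − x_s‖₁ / √s + C₁ ε. -/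
open scoped BigOperators

/-- The Euclidean (ℓ²) norm of a vector. -/
noncomputable def l2 {n : ℕ} (x : Fin n → ℂ) : ℝ := Real.sqrt (∑ i, ‖x i‖ ^ 2)

/-- The ℓ¹ norm of a vector. -/
noncomputable def l1 {n : ℕ} (x : Fin n → ℂ) : ℝ := ∑ i, ‖x i‖

/-- `x` has at most `s` nonzero entries. -/
def Sparse {n : ℕ} (s : ℕ) (x : Fin n → ℂ) : Prop :=
  ∃ T : Finset (Fin n), T.card ≤ s ∧ ∀ i ∉ T, x i = 0

/-- `A` satisfies the restricted isometry property with parameters `(s, δ)`. -/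
def RIP {m d : ℕ} (A : Matrix (Fin m) (Fin d) ℂ) (s : ℕ) (δ : ℝ) : Prop :=
  ∀ x : Fin d → ℂ, Sparse s x →
    (1 - δ) * (l2 x) ^ 2 ≤ (l2 (A.mulVec x)) ^ 2 ∧
      (l2 (A.mulVec x)) ^ 2 ≤ (1 + δ) * (l2 x) ^ 2

/-- The spectral norm `‖M‖₂` of a matrix. -/
noncomputable def specNorm {m d : ℕ} (M : Matrix (Fin m) (Fin d) ℂ) : ℝ :=
  sSup {r | ∃ x : Fin d → ℂ, l2 x ≤ 1 ∧ r = l2 (M.mulVec x)}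

/-- `‖M‖^{(s)}`: the largest spectral norm over all `s`-column submatrices of `M`,
equivalently the sup of `‖Mx‖₂` over `s`-sparse `x` with `‖x‖₂ ≤ 1`. -/
noncomputable def specNormS {m d : ℕ} (s : ℕ) (M : Matrix (Fin m) (Fin d) ℂ) : ℝ :=
  sSup {r | ∃ x : Fin d → ℂ, Sparse s x ∧ l2 x ≤ 1 ∧ r = l2 (M.mulVec x)}

/-- `xs` is a best `s`-sparse approximation of `x`: it keeps `s` entries of `x` of
largest magnitude (all entries if `x` has fewer than `s` coordinates) and sets the
others to zero. -/
def IsSparseApprox {n : ℕ} (s : ℕ) (x xs : Fin n → ℂ) : Prop :=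
  ∃ T : Finset (Fin n), T.card = min s n ∧
    (∀ i, xs i = if i ∈ T then x i else 0) ∧
    ∀ i ∈ T, ∀ j ∉ T, ‖x j‖ ≤ ‖x i‖

lemma l2_eq_norm {n : ℕ} (x : Fin n → ℂ) : l2 x = ‖WithLp.toLp 2 x‖ := by
  rw [EuclideanSpace.norm_eq]
  rfl

lemma l2_nonneg {n : ℕ} (x : Fin n → ℂ) : 0 ≤ l2 x := Real.sqrt_nonneg _

lemma l2_sq {n : ℕ} (x : Fin n → ℂ) : l2 x ^ 2 = ∑ i, ‖x i‖ ^ 2 :=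
  Real.sq_sqrt (Finset.sum_nonneg fun _ _ => sq_nonneg _)

lemma l2_add_le {n : ℕ} (x y : Fin n → ℂ) : l2 (x + y) ≤ l2 x + l2 y := by
  simpa only [l2_eq_norm, WithLp.toLp_add] using norm_add_le (WithLp.toLp 2 x) (WithLp.toLp 2 y)

lemma l2_neg {n : ℕ} (x : Fin n → ℂ) : l2 (-x) = l2 x := by
  simp [l2]

lemma l2_sub_le {n : ℕ} (x y : Fin n → ℂ) : l2 (x - y) ≤ l2 x + l2 y := by
  simpa only [sub_eq_add_neg, l2_neg] using l2_add_le x (-y)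

/-- The Cauchy–Schwarz bound for the `ℓ¹` mass of a vector on a finite set. -/
lemma sum_norm_le_sqrt_card_mul_l2 {n : ℕ} (x : Fin n → ℂ) (T : Finset (Fin n)) :
    ∑ i ∈ T, ‖x i‖ ≤ Real.sqrt T.card * l2 x := by
  refine le_of_sq_le_sq ?_ (mul_nonneg (Real.sqrt_nonneg _) (l2_nonneg x))
  rw [mul_pow, Real.sq_sqrt (Nat.cast_nonneg _), l2_sq]
  refine sq_sum_le_card_mul_sum_sq.trans ?_
  gcongr
  exact Finset.subset_univ T

/-- A vector supported on `T` with entries bounded by `b` has `ℓ²` norm at most `√#T * b`. -/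
lemma l2_le_sqrt_card_mul {n : ℕ} {x : Fin n → ℂ} {T : Finset (Fin n)} {b : ℝ}
    (hb : 0 ≤ b) (hT : ∀ i ∉ T, x i = 0) (hx : ∀ i ∈ T, ‖x i‖ ≤ b) :
    l2 x ≤ Real.sqrt T.card * b := by
  refine le_of_sq_le_sq ?_ (by positivity)
  rw [mul_pow, Real.sq_sqrt (Nat.cast_nonneg _), l2_sq,
    ← Finset.sum_subset (Finset.subset_univ T) fun i _ hi => by simp [hT i hi], ← nsmul_eq_mul]
  refine Finset.sum_le_card_nsmul _ _ _ fun i hi => ?_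
  have := hx i hi
  gcongr

/-- Every finite set contains a subset of prescribed size on which `f` is largest. -/
lemma Finset.exists_subset_card_eq_forall_le {α : Type*} [DecidableEq α] (f : α → ℝ)
    (S : Finset α) (N : ℕ) (hN : N ≤ S.card) :
    ∃ T ⊆ S, T.card = N ∧ ∀ i ∈ T, ∀ j ∈ S \ T, f j ≤ f i := by
  induction N with
  | zero => exact ⟨∅, by simp⟩
  | succ N ih =>
    obtain ⟨T, hTS, hT, hmax⟩ := ih (by omega)
    have hne : (S \ T).Nonempty := by
      rw [← Finset.card_pos, Finset.card_sdiff_of_subset hTS]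
      omega
    obtain ⟨k, hk, hkmax⟩ := Finset.exists_max_image (S \ T) f hne
    have hk' := Finset.mem_sdiff.1 hk
    refine ⟨insert k T, Finset.insert_subset hk'.1 hTS, ?_, fun i hi j hj => ?_⟩
    · rw [Finset.card_insert_of_notMem hk'.2, hT]
    · have hj' : j ∈ S \ T := by simp_all
      rcases Finset.mem_insert.1 hi with rfl | hi
      · exact hkmax j hj'
      · exact hmax i hi j hj'

/-- Block decomposition: after removing suitable `N` entries from `v`, every subadditive functional
that is bounded by `K` times the `ℓ²` norm on `N`-sparse vectors is at most `K ‖v‖₁ / √N`. -/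
lemma exists_tail_bound {d : ℕ} (N : ℕ) (hN : 1 ≤ N) (S : Finset (Fin d)) (v : Fin d → ℂ)
    (hv : ∀ i ∉ S, v i = 0) :
    ∃ T ⊆ S, T.card ≤ N ∧
      ∀ (p : (Fin d → ℂ) → ℝ) (K : ℝ), 0 ≤ K → (∀ x y, p (x + y) ≤ p x + p y) →
        (∀ x, Sparse N x → p x ≤ K * l2 x) →
        p (fun i => if i ∈ T then 0 else v i) ≤ K * (l1 v / Real.sqrt N) := by
  induction hS : S.card using Nat.strong_induction_on generalizing S v with
  | _ n ih =>
  rcases le_or_gt S.card N with h | h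
  · refine ⟨S, subset_rfl, h, fun p K hK _ hp => ?_⟩
    have h0 : (fun i => if i ∈ S then 0 else v i) = (0 : Fin d → ℂ) := by
      ext i
      by_cases hi : i ∈ S <;> simp [hi, hv]
    rw [h0]
    have h1 : 0 ≤ l1 v := Finset.sum_nonneg fun _ _ => norm_nonneg _
    calc p 0 ≤ K * l2 (0 : Fin d → ℂ) := hp 0 ⟨∅, by simp⟩
      _ = 0 := by simp [l2]
      _ ≤ _ := by positivity
  · obtain ⟨T, hTS, hT, hmax⟩ :=
      Finset.exists_subset_card_eq_forall_le (fun i => ‖v i‖) S N h.le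
    have hN0 : (0 : ℝ) < N := by exact_mod_cast hN
    have havg : ∀ i ∈ S \ T, ‖v i‖ ≤ (∑ j ∈ T, ‖v j‖) / N := fun i hi => by
      rw [le_div_iff₀ hN0, mul_comm, ← hT, ← nsmul_eq_mul]
      exact Finset.card_nsmul_le_sum _ _ _ fun j hj => hmax j hj i hi
    refine ⟨T, hTS, hT.le, fun p K hK hadd hp => ?_⟩
    set w : Fin d → ℂ := fun i => if i ∈ T then 0 else v i with hw
    obtain ⟨T', hT'S, hT', hbound⟩ := ih (S \ T).card
      (by rw [Finset.card_sdiff_of_subset hTS]; omega) (S \ T) w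
      (fun i hi => by
        by_cases hiT : i ∈ T
        · simp [hw, hiT]
        · simpa [hw, hiT] using hv i (by simp_all)) rfl
    set u : Fin d → ℂ := fun i => if i ∈ T' then w i else 0 with hu
    have hsplit : w = u + fun i => if i ∈ T' then 0 else w i := by
      ext i
      by_cases hi : i ∈ T' <;> simp [hu, hi]
    have hb : 0 ≤ (∑ j ∈ T, ‖v j‖) / N := by positivity
    have hu0 : ∀ i ∉ T', u i = 0 := fun i hi => by simp [hu, hi]
    have hu2 : l2 u ≤ (∑ j ∈ T, ‖v j‖) / Real.sqrt N := by
      refine (l2_le_sqrt_card_mul hb hu0 fun i hi => ?_).trans ?_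
      · have hiS := hT'S hi
        simpa [hu, hw, hi, (Finset.mem_sdiff.1 hiS).2] using havg i hiS
      · calc Real.sqrt T'.card * ((∑ j ∈ T, ‖v j‖) / N)
            ≤ Real.sqrt N * ((∑ j ∈ T, ‖v j‖) / N) := by gcongr
          _ = (∑ j ∈ T, ‖v j‖) / Real.sqrt N := by
            have hs0 : Real.sqrt N ≠ 0 := (Real.sqrt_pos.2 hN0).ne'
            field_simp
            rw [Real.sq_sqrt hN0.le, mul_comm]
    have hl1 : l1 v = (∑ j ∈ T, ‖v j‖) + l1 w := by
      have hind : ∑ j ∈ T, ‖v j‖ = ∑ j, if j ∈ T then ‖v j‖ else 0 := by simp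
      rw [l1, l1, hind, ← Finset.sum_add_distrib]
      refine Finset.sum_congr rfl fun i _ => ?_
      by_cases hi : i ∈ T <;> simp [hw, hi]
    calc p w ≤ p u + p (fun i => if i ∈ T' then 0 else w i) := by
          conv_lhs => rw [hsplit]
          exact hadd _ _
      _ ≤ K * ((∑ j ∈ T, ‖v j‖) / Real.sqrt N) + K * (l1 w / Real.sqrt N) :=
          add_le_add ((hp u ⟨T', hT', hu0⟩).trans (by gcongr)) (hbound p K hK hadd hp)
      _ = K * (l1 v / Real.sqrt N) := by rw [hl1]; ring

/-- If `‖z‖₁ ≤ ‖x‖₁`, the error `z - x` satisfies the cone condition relative to any set `T`. -/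
lemma cone_condition {d : ℕ} (x z : Fin d → ℂ) (T : Finset (Fin d)) (h : l1 z ≤ l1 x) :
    l1 (fun i => if i ∈ T then 0 else (z - x) i) ≤
      ∑ i ∈ T, ‖(z - x) i‖ + 2 * l1 (fun i => if i ∈ T then 0 else x i) := by
  have hind : ∑ i ∈ T, ‖(z - x) i‖ = ∑ i, if i ∈ T then ‖(z - x) i‖ else 0 := by simp
  have key : l1 (fun i => if i ∈ T then 0 else (z - x) i) + l1 x ≤
      (∑ i ∈ T, ‖(z - x) i‖ + 2 * l1 (fun i => if i ∈ T then 0 else x i)) + l1 z := by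
    simp only [l1]
    rw [hind, Finset.mul_sum, ← Finset.sum_add_distrib, ← Finset.sum_add_distrib,
      ← Finset.sum_add_distrib]
    refine Finset.sum_le_sum fun i _ => ?_
    have h1 := norm_sub_le (z i) (x i)
    have h2 := norm_sub_norm_le (x i) (z i)
    rw [norm_sub_rev] at h2
    by_cases hi : i ∈ T <;> simp only [hi, if_true, if_false, norm_zero, Pi.sub_apply] <;> linarith
  linarith

/-- Basis Pursuit recovery under RIP with parameters `(3s, 0.2)`
(Candès–Romberg–Tao). -/
theorem bp_recovery_rip_3s (s : ℕ) (hs : 1 ≤ s) :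
    ∃ C₀ C₁ : ℝ, 0 < C₀ ∧ 0 < C₁ ∧
      ∀ (m d : ℕ) (A : Matrix (Fin m) (Fin d) ℂ) (x xs xstar : Fin d → ℂ)
        (e : Fin m → ℂ) (ε : ℝ),
        0 ≤ ε → l2 e ≤ ε →
        RIP A (3 * s) 0.2 →
        IsSparseApprox s x xs →
        -- `xstar` is a minimizer of the Basis Pursuit problem with data `y = Ax + e`
        (l2 (A.mulVec xstar - (A.mulVec x + e)) ≤ ε ∧
          ∀ z : Fin d → ℂ, l2 (A.mulVec z - (A.mulVec x + e)) ≤ ε → l1 xstar ≤ l1 z) →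
        l2 (xstar - x) ≤ C₀ * l1 (x - xs) / Real.sqrt s + C₁ * ε := by
  refine ⟨40, 40, by norm_num, by norm_num, ?_⟩
  intro m d A x xs xstar e ε hε he hRIP ⟨T₀, hT₀card, hxs, _⟩ ⟨hfeas, hmin⟩
  have hs0 : (0 : ℝ) < s := by exact_mod_cast hs
  have hle : l1 xstar ≤ l1 x := hmin x (by simpa [l2_neg] using he)
  set h : Fin d → ℂ := xstar - x with hh
  have hσ : l1 (fun i => if i ∈ T₀ then 0 else x i) = l1 (x - xs) := by
    refine congrArg l1 (funext fun i => ?_)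
    by_cases hi : i ∈ T₀ <;> simp [hxs, hi]
  have hcone := cone_condition x xstar T₀ hle
  rw [hσ, ← hh] at hcone
  have hAh : l2 (A.mulVec h) ≤ 2 * ε := by
    have heq : A.mulVec h = (A.mulVec xstar - (A.mulVec x + e)) + e := by
      rw [hh, Matrix.mulVec_sub]
      abel
    rw [heq]
    linarith [l2_add_le (A.mulVec xstar - (A.mulVec x + e)) e]
  set v : Fin d → ℂ := fun i => if i ∈ T₀ then 0 else h i with hv
  obtain ⟨T, -, hTcard, htail⟩ :=
    exists_tail_bound (2 * s) (by omega) Finset.univ v (by simp)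
  set w : Fin d → ℂ := fun i => if i ∈ T then 0 else v i with hw
  set g : Fin d → ℂ := h - w with hg
  have hgi : ∀ i, g i = if i ∈ T₀ ∪ T then h i else 0 := fun i => by
    by_cases hi : i ∈ T₀ <;> by_cases hi' : i ∈ T <;> simp [hg, hw, hv, hi, hi']
  have hgsparse : Sparse (3 * s) g := by
    refine ⟨T₀ ∪ T, ?_, fun i hi => by rw [hgi, if_neg hi]⟩
    have := Finset.card_union_le T₀ T
    omega
  have hw2 : l2 w ≤ l1 v / Real.sqrt (2 * s : ℕ) := by
    simpa using htail l2 1 zero_le_one l2_add_le fun _ _ => by simp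
  have hAw : l2 (A.mulVec w) ≤ 1.0955 * (l1 v / Real.sqrt (2 * s : ℕ)) := by
    refine htail (fun z => l2 (A.mulVec z)) 1.0955 (by norm_num)
      (fun y z => by simpa only [Matrix.mulVec_add] using l2_add_le _ _) ?_
    rintro z ⟨U, hU, hz⟩
    have hz2 := (hRIP z ⟨U, by omega, hz⟩).2
    refine le_of_sq_le_sq ?_ (mul_nonneg (by norm_num) (l2_nonneg z))
    rw [mul_pow]
    nlinarith [sq_nonneg (l2 z)]
  have hAg : 0.894 * l2 g ≤ l2 (A.mulVec g) := by
    refine le_of_sq_le_sq ?_ (l2_nonneg _)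
    rw [mul_pow]
    nlinarith [sq_nonneg (l2 g), (hRIP g hgsparse).1]
  have hAg' : l2 (A.mulVec g) ≤ l2 (A.mulVec h) + l2 (A.mulVec w) := by
    rw [hg, Matrix.mulVec_sub]
    exact l2_sub_le _ _
  have hh2 : l2 h ≤ l2 g + l2 w := by
    simpa [hg] using l2_add_le g w
  have hT₀ : ∑ i ∈ T₀, ‖h i‖ ≤ Real.sqrt s * l2 g := by
    have hsum : ∑ i ∈ T₀, ‖h i‖ = ∑ i ∈ T₀, ‖g i‖ :=
      Finset.sum_congr rfl fun i hi => by rw [hgi, if_pos (Finset.mem_union_left _ hi)]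
    have hcard : T₀.card ≤ s := by omega
    have hg0 := l2_nonneg g
    calc ∑ i ∈ T₀, ‖h i‖ ≤ Real.sqrt T₀.card * l2 g := hsum ▸ sum_norm_le_sqrt_card_mul_l2 g T₀
      _ ≤ Real.sqrt s * l2 g := by gcongr
  have hσ0 : 0 ≤ l1 (x - xs) := Finset.sum_nonneg fun _ _ => norm_nonneg _
  have hsq : 0 < Real.sqrt s := Real.sqrt_pos.2 hs0
  have hR : l1 v / Real.sqrt (2 * s : ℕ) ≤ 0.7072 * (l2 g + 2 * (l1 (x - xs) / Real.sqrt s)) := by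
    have h2 : 1 ≤ 0.7072 * Real.sqrt 2 := by
      have : (1.4141 : ℝ) ≤ Real.sqrt 2 := Real.le_sqrt_of_sq_le (by norm_num)
      linarith
    rw [Nat.cast_mul, Nat.cast_ofNat, Real.sqrt_mul zero_le_two, div_le_iff₀ (by positivity)]
    calc l1 v ≤ 1 * (Real.sqrt s * l2 g + 2 * l1 (x - xs)) := by linarith
      _ ≤ 0.7072 * Real.sqrt 2 * (Real.sqrt s * l2 g + 2 * l1 (x - xs)) := by
        have hg0 := l2_nonneg g
        gcongr
      _ = _ := by field_simp
  have hτ0 : 0 ≤ l1 (x - xs) / Real.sqrt s := by positivity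
  rw [mul_div_assoc]
  linarith
end

section
/- Let s ≥ 1 and let 0 ≤ δ < √2 − 1. There exist constants C₀, C₁ > 0 (depending only on δ) such that the following holds. Let A ∈ ℂ^{m×d} satisfy the restricted isometry property with parameters (2s, δ). Let x ∈ ℂ^d be arbitrary, let e ∈ ℂ^m satisfy ‖e‖₂ ≤ ε for some ε ≥ 0, and set y = Ax + e. Then any minimizer x⋆ of the Basis Pursuit problem min ‖z‖₁ subject to ‖Az − y‖₂ ≤ ε satisfies ‖x⋆ − x‖₂ ≤ C₀ ‖x − x_s‖₁ / √s + C₁ ε. -/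
open scoped BigOperators

lemma l2_ofReal_smul {n : ℕ} {a : ℝ} (ha : 0 ≤ a) (x : Fin n → ℂ) :
    l2 ((a : ℂ) • x) = a * l2 x := by
  simp [l2_eq_norm, norm_smul, abs_of_nonneg ha]

lemma eq_zero_of_l2_eq_zero {n : ℕ} {x : Fin n → ℂ} (h : l2 x = 0) : x = 0 := by
  simpa [l2_eq_norm] using h

lemma l2_list_sum_le {n : ℕ} (L : List (Fin n → ℂ)) : l2 L.sum ≤ (L.map l2).sum := by
  induction L with
  | nil => simp [l2]
  | cons v L ih =>
    simp only [List.sum_cons, List.map_cons]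
    linarith [l2_add_le v L.sum]

/-- The real part of the standard inner product. -/
noncomputable def reInner {n : ℕ} (x y : Fin n → ℂ) : ℝ :=
  RCLike.re (inner ℂ (WithLp.toLp 2 x) (WithLp.toLp 2 y))

lemma reInner_self {n : ℕ} (x : Fin n → ℂ) : reInner x x = l2 x ^ 2 := by
  rw [l2_eq_norm, reInner, inner_self_eq_norm_sq]

lemma reInner_add_left {n : ℕ} (x y z : Fin n → ℂ) :
    reInner (x + y) z = reInner x z + reInner y z := by
  simp [reInner]

lemma reInner_add_right {n : ℕ} (x y z : Fin n → ℂ) :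
    reInner x (y + z) = reInner x y + reInner x z := by
  simp [reInner]

lemma reInner_zero_left {n : ℕ} (x : Fin n → ℂ) : reInner 0 x = 0 := by
  simp [reInner]

lemma reInner_zero_right {n : ℕ} (x : Fin n → ℂ) : reInner x 0 = 0 := by
  simp [reInner]

lemma reInner_ofReal_smul {n : ℕ} (a b : ℝ) (x y : Fin n → ℂ) :
    reInner ((a : ℂ) • x) ((b : ℂ) • y) = a * b * reInner x y := by
  simp [reInner]
  ring

lemma reInner_le {n : ℕ} (x y : Fin n → ℂ) : reInner x y ≤ l2 x * l2 y := by
  rw [l2_eq_norm, l2_eq_norm]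
  exact re_inner_le_norm _ _

lemma l2_add_sq {n : ℕ} (x y : Fin n → ℂ) :
    l2 (x + y) ^ 2 = l2 x ^ 2 + 2 * reInner x y + l2 y ^ 2 := by
  simpa [l2_eq_norm, reInner] using
    norm_add_sq (𝕜 := ℂ) (WithLp.toLp 2 x) (WithLp.toLp 2 y)

lemma l2_sub_sq {n : ℕ} (x y : Fin n → ℂ) :
    l2 (x - y) ^ 2 = l2 x ^ 2 - 2 * reInner x y + l2 y ^ 2 := by
  simpa [l2_eq_norm, reInner] using
    norm_sub_sq (𝕜 := ℂ) (WithLp.toLp 2 x) (WithLp.toLp 2 y)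

lemma reInner_eq_zero_of_disjoint {n : ℕ} {U V : Finset (Fin n)} (hUV : Disjoint U V)
    {u v : Fin n → ℂ} (hu : ∀ i ∉ U, u i = 0) (hv : ∀ i ∉ V, v i = 0) :
    reInner u v = 0 := by
  have h : inner ℂ (WithLp.toLp 2 u) (WithLp.toLp 2 v) = 0 := by
    rw [PiLp.inner_apply]
    refine Finset.sum_eq_zero fun i _ => ?_
    by_cases hi : i ∈ U
    · simp [hv i (Finset.disjoint_left.1 hUV hi)]
    · simp [hu i hi]
  simp [reInner, h]

lemma RIP.neg_reInner_le_of_disjoint {m d s : ℕ} {A : Matrix (Fin m) (Fin d) ℂ} {δ : ℝ}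
    (hA : RIP A (2 * s) δ) {U V : Finset (Fin d)} (hUV : Disjoint U V)
    (hU : U.card ≤ s) (hV : V.card ≤ s) {u v : Fin d → ℂ}
    (hu : ∀ i ∉ U, u i = 0) (hv : ∀ i ∉ V, v i = 0) :
    -reInner (A.mulVec u) (A.mulVec v) ≤ δ * l2 u * l2 v := by
  rcases (l2_nonneg u).eq_or_lt with h0 | hupos
  · simp [eq_zero_of_l2_eq_zero h0.symm, reInner_zero_left, l2]
  rcases (l2_nonneg v).eq_or_lt with h0 | hvpos
  · simp [eq_zero_of_l2_eq_zero h0.symm, reInner_zero_right, l2]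
  set a := l2 u with ha
  set b := l2 v with hb
  set p : Fin d → ℂ := (b : ℂ) • u with hp
  set q : Fin d → ℂ := (a : ℂ) • v with hq
  have hp0 : ∀ i ∉ U, p i = 0 := fun i hi => by simp [hp, hu i hi]
  have hq0 : ∀ i ∉ V, q i = 0 := fun i hi => by simp [hq, hv i hi]
  have hcard : (U ∪ V).card ≤ 2 * s := (Finset.card_union_le U V).trans (by omega)
  have hadd : Sparse (2 * s) (p + q) := ⟨U ∪ V, hcard, fun i hi => by
    rw [Finset.mem_union, not_or] at hi
    simp [hp0 i hi.1, hq0 i hi.2]⟩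
  have hsub : Sparse (2 * s) (p - q) := ⟨U ∪ V, hcard, fun i hi => by
    rw [Finset.mem_union, not_or] at hi
    simp [hp0 i hi.1, hq0 i hi.2]⟩
  have h1 := (hA _ hadd).1
  have h2 := (hA _ hsub).2
  rw [Matrix.mulVec_add, l2_add_sq, l2_add_sq, reInner_eq_zero_of_disjoint hUV hp0 hq0] at h1
  rw [Matrix.mulVec_sub, l2_sub_sq, l2_sub_sq, reInner_eq_zero_of_disjoint hUV hp0 hq0] at h2
  have hpn : l2 p = b * a := l2_ofReal_smul hvpos.le u
  have hqn : l2 q = a * b := l2_ofReal_smul hupos.le v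
  have hpq : reInner (A.mulVec p) (A.mulVec q)
      = b * a * reInner (A.mulVec u) (A.mulVec v) := by
    rw [hp, hq, Matrix.mulVec_smul, Matrix.mulVec_smul, reInner_ofReal_smul]
  rw [hpq, hpn, hqn] at h1 h2
  have hab : 0 < a * b := mul_pos hupos hvpos
  refine le_of_mul_le_mul_left ?_ hab
  nlinarith

lemma neg_reInner_list_sum_le {m d : ℕ} (A : Matrix (Fin m) (Fin d) ℂ) (w : Fin m → ℂ)
    (c : ℝ) (L : List (Fin d → ℂ)) (hL : ∀ v ∈ L, -reInner w (A.mulVec v) ≤ c * l2 v) :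
    -reInner w (A.mulVec L.sum) ≤ c * (L.map l2).sum := by
  induction L with
  | nil => simp [reInner_zero_right]
  | cons v L ih =>
    have h1 := hL v (by simp)
    have h2 := ih fun v hv => hL v (by simp [hv])
    simp only [List.sum_cons, List.map_cons, Matrix.mulVec_add, reInner_add_right]
    linarith

/-- The restriction of `x` to the coordinates in `S`, extended by zero. -/
def restrictTo {n : ℕ} (S : Finset (Fin n)) (x : Fin n → ℂ) : Fin n → ℂ :=
  fun i => if i ∈ S then x i else 0

lemma restrictTo_of_notMem {n : ℕ} (S : Finset (Fin n)) (x : Fin n → ℂ) :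
    ∀ i ∉ S, restrictTo S x i = 0 := fun i hi => by simp [restrictTo, hi]

lemma restrictTo_add_sdiff {n : ℕ} {S T : Finset (Fin n)} (hT : T ⊆ S) (x : Fin n → ℂ) :
    restrictTo T x + restrictTo (S \ T) x = restrictTo S x := by
  ext i
  by_cases h1 : i ∈ T
  · simp [restrictTo, h1, hT h1]
  · simp [restrictTo, h1]

lemma l2_restrictTo_sq {n : ℕ} (S : Finset (Fin n)) (x : Fin n → ℂ) :
    l2 (restrictTo S x) ^ 2 = ∑ i ∈ S, ‖x i‖ ^ 2 := by
  rw [l2_sq, ← Finset.sum_subset (Finset.subset_univ S)]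
  · exact Finset.sum_congr rfl fun i hi => by simp [restrictTo, hi]
  · intro i _ hi
    simp [restrictTo, hi]

lemma sum_norm_le_sqrt_mul_l2 {n s : ℕ} {S : Finset (Fin n)} (hS : S.card ≤ s)
    (x : Fin n → ℂ) : ∑ i ∈ S, ‖x i‖ ≤ √s * l2 (restrictTo S x) := by
  refine le_of_sq_le_sq ?_ (mul_nonneg (Real.sqrt_nonneg _) (l2_nonneg _))
  rw [mul_pow, Real.sq_sqrt (Nat.cast_nonneg _), l2_restrictTo_sq]
  refine sq_sum_le_card_mul_sum_sq.trans ?_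
  gcongr

lemma exists_subset_card_eq_largest {ι : Type*} [DecidableEq ι] (f : ι → ℝ) (S : Finset ι)
    (k : ℕ) (hk : k ≤ S.card) :
    ∃ T ⊆ S, T.card = k ∧ ∀ i ∈ T, ∀ j ∈ S \ T, f j ≤ f i := by
  induction k with
  | zero => exact ⟨∅, by simp⟩
  | succ k ih =>
    obtain ⟨T, hTS, hT, hf⟩ := ih (by omega)
    have hne : (S \ T).Nonempty := by
      rw [← Finset.card_pos, Finset.card_sdiff_of_subset hTS]
      omega
    obtain ⟨a, ha, hmax⟩ := Finset.exists_max_image (S \ T) f hne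
    have haS := (Finset.mem_sdiff.1 ha).1
    have haT := (Finset.mem_sdiff.1 ha).2
    refine ⟨insert a T, Finset.insert_subset haS hTS, by simp [haT, hT], ?_⟩
    intro i hi j hj
    have hj' : j ∈ S \ T := by
      simp only [Finset.mem_sdiff, Finset.mem_insert, not_or] at hj ⊢
      exact ⟨hj.1, hj.2.2⟩
    rcases Finset.mem_insert.1 hi with rfl | hi
    · exact hmax j hj'
    · exact hf i hi j hj'

lemma l2_restrictTo_le_of_dominated {n s : ℕ} (hs : 1 ≤ s) {T U : Finset (Fin n)}
    (hT : T.card = s) (hU : U.card ≤ s) (x : Fin n → ℂ)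
    (hx : ∀ i ∈ T, ∀ j ∈ U, ‖x j‖ ≤ ‖x i‖) :
    l2 (restrictTo U x) ≤ (∑ i ∈ T, ‖x i‖) / √s := by
  have hs0 : (0 : ℝ) < s := by exact_mod_cast hs
  set M := ∑ i ∈ T, ‖x i‖ with hM
  have hM0 : 0 ≤ M := by positivity
  refine le_of_sq_le_sq ?_ (by positivity)
  rw [l2_restrictTo_sq, div_pow, Real.sq_sqrt hs0.le]
  have hj : ∀ j ∈ U, ‖x j‖ ^ 2 ≤ (M / s) ^ 2 := fun j hj => by
    have : (s : ℝ) * ‖x j‖ ≤ M := by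
      rw [← hT, ← nsmul_eq_mul]
      exact Finset.card_nsmul_le_sum _ _ _ fun i hi => hx i hi j hj
    gcongr
    rw [le_div_iff₀ hs0]
    linarith
  calc ∑ j ∈ U, ‖x j‖ ^ 2 ≤ U.card • (M / s) ^ 2 := Finset.sum_le_card_nsmul _ _ _ hj
    _ ≤ s * (M / s) ^ 2 := by
      rw [nsmul_eq_mul]
      gcongr
    _ = M ^ 2 / s := by field_simp

/-- Splitting the coordinates in `S` into blocks of size `s` of decreasing magnitude: all blocks
but the leading one have total `ℓ²` norm at most `1 / √s` times the `ℓ¹` norm on `S`. -/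
lemma exists_block_decomposition {n s : ℕ} (hs : 1 ≤ s) (x : Fin n → ℂ) (S : Finset (Fin n)) :
    ∃ T ⊆ S, T.card ≤ s ∧ ∃ L : List (Fin n → ℂ), restrictTo (S \ T) x = L.sum ∧
      (∀ v ∈ L, ∃ V ⊆ S \ T, V.card ≤ s ∧ ∀ i ∉ V, v i = 0) ∧
      (L.map l2).sum ≤ (∑ i ∈ S, ‖x i‖) / √s := by
  induction S using Finset.strongInduction with
  | H S ih =>
    by_cases hS : S.card ≤ s
    · refine ⟨S, subset_rfl, hS, [], ?_, by simp, ?_⟩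
      · ext i
        simp [restrictTo]
      · simp only [List.map_nil, List.sum_nil]
        positivity
    obtain ⟨T, hTS, hT, hmax⟩ :=
      exists_subset_card_eq_largest (fun i => ‖x i‖) S s (by omega)
    have hTne : T.Nonempty := Finset.card_pos.1 (by omega)
    obtain ⟨T', hT'S, hT', L, hsum, hL, hbound⟩ := ih (S \ T) (Finset.sdiff_ssubset hTS hTne)
    refine ⟨T, hTS, hT.le, restrictTo T' x :: L, ?_, ?_, ?_⟩
    · rw [List.sum_cons, ← hsum, restrictTo_add_sdiff hT'S]
    · intro v hv
      rcases List.mem_cons.1 hv with rfl | hv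
      · exact ⟨T', hT'S, hT', restrictTo_of_notMem T' x⟩
      · obtain ⟨V, hV, hV'⟩ := hL v hv
        exact ⟨V, hV.trans Finset.sdiff_subset, hV'⟩
    · have h := l2_restrictTo_le_of_dominated hs hT hT' x
        fun i hi j hj => hmax i hi j (hT'S hj)
      rw [List.map_cons, List.sum_cons, ← Finset.sum_sdiff hTS, add_div]
      linarith

/-- If `y` has `ℓ¹` norm at most that of `x`, then `y - x` is concentrated on `T` up to the
`ℓ¹` norm of `x` off `T`. -/
lemma sum_compl_norm_le_of_l1_le {n : ℕ} {x y : Fin n → ℂ} (h : l1 y ≤ l1 x)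
    (T : Finset (Fin n)) :
    ∑ i ∈ Tᶜ, ‖(y - x) i‖ ≤ ∑ i ∈ T, ‖(y - x) i‖ + 2 * ∑ i ∈ Tᶜ, ‖x i‖ := by
  unfold l1 at h
  rw [← Finset.sum_add_sum_compl T, ← Finset.sum_add_sum_compl T (fun i => ‖x i‖)] at h
  have h1 : ∑ i ∈ T, ‖x i‖ ≤ ∑ i ∈ T, ‖(y - x) i‖ + ∑ i ∈ T, ‖y i‖ := by
    rw [← Finset.sum_add_distrib]
    refine Finset.sum_le_sum fun i _ => ?_
    have := norm_sub_le (y i) ((y - x) i)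
    simp only [Pi.sub_apply, sub_sub_cancel] at this ⊢
    linarith
  have h2 : ∑ i ∈ Tᶜ, ‖(y - x) i‖ ≤ ∑ i ∈ Tᶜ, ‖y i‖ + ∑ i ∈ Tᶜ, ‖x i‖ := by
    rw [← Finset.sum_add_distrib]
    exact Finset.sum_le_sum fun i _ => norm_sub_le (y i) (x i)
  linarith

/-- Under the RIP, a vector `h` is controlled in `ℓ²` on `T` together with the leading block of
`Tᶜ` by its measurement and by its `ℓ¹` norm off `T`; the rest is controlled by the latter. -/
lemma RIP.exists_head_tail_bound {m d s : ℕ} {A : Matrix (Fin m) (Fin d) ℂ} {δ : ℝ}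
    (hs : 1 ≤ s) (hδ : 0 ≤ δ) (hA : RIP A (2 * s) δ) (h : Fin d → ℂ) {T : Finset (Fin d)}
    (hT : T.card ≤ s) :
    ∃ X : ℝ, l2 (restrictTo T h) ≤ X ∧ l2 h ≤ X + (∑ i ∈ Tᶜ, ‖h i‖) / √s ∧
      (1 - δ) * X ≤ √(1 + δ) * l2 (A.mulVec h) + √2 * δ * ((∑ i ∈ Tᶜ, ‖h i‖) / √s) := by
  obtain ⟨T₁, hT₁, hT₁s, L, hsum, hL, hbound⟩ := exists_block_decomposition hs h Tᶜ
  have hdisj : Disjoint T T₁ := Finset.disjoint_left.2 fun i hi hi' => by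
    simpa [hi] using hT₁ hi'
  set σ := (∑ i ∈ Tᶜ, ‖h i‖) / √s
  set u := restrictTo T h with hu
  set v := restrictTo T₁ h with hv
  have hu0 : ∀ i ∉ T, u i = 0 := restrictTo_of_notMem T h
  have hv0 : ∀ i ∉ T₁, v i = 0 := restrictTo_of_notMem T₁ h
  have hdecomp : h = (u + v) + L.sum := by
    rw [← hsum, add_assoc, hv, restrictTo_add_sdiff hT₁, hu, Finset.compl_eq_univ_sdiff,
      restrictTo_add_sdiff (Finset.subset_univ T)]
    ext i
    simp [restrictTo]
  have hsq : l2 (u + v) ^ 2 = l2 u ^ 2 + l2 v ^ 2 := by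
    rw [l2_add_sq, reInner_eq_zero_of_disjoint hdisj hu0 hv0]
    ring
  have hX0 := l2_nonneg (u + v)
  have hsqrt : l2 u + l2 v ≤ √2 * l2 (u + v) := by
    refine le_of_sq_le_sq ?_ (by positivity)
    rw [mul_pow, Real.sq_sqrt (by norm_num), hsq]
    nlinarith [sq_nonneg (l2 u - l2 v)]
  have hsparse : Sparse (2 * s) (u + v) :=
    ⟨T ∪ T₁, (Finset.card_union_le T T₁).trans (by omega), fun i hi => by
      rw [Finset.mem_union, not_or] at hi
      simp [hu0 i hi.1, hv0 i hi.2]⟩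
  obtain ⟨hlow, hupp⟩ := hA _ hsparse
  have htail : -reInner (A.mulVec (u + v)) (A.mulVec L.sum)
      ≤ δ * (√2 * l2 (u + v)) * (L.map l2).sum := by
    refine neg_reInner_list_sum_le A _ _ L fun w hw => ?_
    obtain ⟨W, hW, hWs, hw0⟩ := hL w hw
    have hTW : Disjoint T W := Finset.disjoint_left.2 fun i hi hi' => by
      simpa [hi] using hW hi'
    have hT₁W : Disjoint T₁ W := Finset.disjoint_left.2 fun i hi hi' => by
      simpa [hi] using hW hi'
    have h1 := hA.neg_reInner_le_of_disjoint hTW hT hWs hu0 hw0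
    have h2 := hA.neg_reInner_le_of_disjoint hT₁W hT₁s hWs hv0 hw0
    rw [Matrix.mulVec_add, reInner_add_left]
    have h3 := mul_le_mul_of_nonneg_right (mul_le_mul_of_nonneg_left hsqrt hδ) (l2_nonneg w)
    linarith
  have hnorm : l2 (A.mulVec (u + v)) ≤ √(1 + δ) * l2 (u + v) := by
    refine le_of_sq_le_sq ?_ (by positivity)
    rwa [mul_pow, Real.sq_sqrt (by positivity)]
  have hinner : reInner (A.mulVec (u + v)) (A.mulVec h)
      = l2 (A.mulVec (u + v)) ^ 2 + reInner (A.mulVec (u + v)) (A.mulVec L.sum) := by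
    conv_lhs => rw [hdecomp, Matrix.mulVec_add _ (u + v) L.sum, reInner_add_right]
    rw [reInner_self]
  have hCS := (reInner_le (A.mulVec (u + v)) (A.mulVec h)).trans
    (mul_le_mul_of_nonneg_right hnorm (l2_nonneg _))
  have htail' : δ * (√2 * l2 (u + v)) * (L.map l2).sum ≤ δ * (√2 * l2 (u + v)) * σ :=
    mul_le_mul_of_nonneg_left hbound (by positivity)
  refine ⟨l2 (u + v), ?_, ?_, ?_⟩
  · refine le_of_sq_le_sq ?_ hX0
    nlinarith [sq_nonneg (l2 v)]
  · have h1 := l2_add_le (u + v) L.sum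
    rw [← hdecomp] at h1
    linarith [l2_list_sum_le L]
  · rcases hX0.eq_or_lt with h0 | hpos
    · rw [← h0, mul_zero]
      have := l2_nonneg (A.mulVec h)
      positivity
    · refine le_of_mul_le_mul_right ?_ hpos
      nlinarith

/-- Basis Pursuit recovery under RIP with parameters `(2s, δ)` for `δ < √2 - 1`
(Candès). The constants depend only on `δ`. -/
theorem bp_recovery_rip_2s (δ : ℝ) (hδ0 : 0 ≤ δ) (hδ : δ < Real.sqrt 2 - 1) :
    ∃ C₀ C₁ : ℝ, 0 < C₀ ∧ 0 < C₁ ∧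
      ∀ (s : ℕ), 1 ≤ s →
      ∀ (m d : ℕ) (A : Matrix (Fin m) (Fin d) ℂ) (x xs xstar : Fin d → ℂ)
        (e : Fin m → ℂ) (ε : ℝ),
        0 ≤ ε → l2 e ≤ ε →
        RIP A (2 * s) δ →
        IsSparseApprox s x xs →
        -- `xstar` is a minimizer of the Basis Pursuit problem with data `y = Ax + e`
        (l2 (A.mulVec xstar - (A.mulVec x + e)) ≤ ε ∧
          ∀ z : Fin d → ℂ, l2 (A.mulVec z - (A.mulVec x + e)) ≤ ε → l1 xstar ≤ l1 z) →
        l2 (xstar - x) ≤ C₀ * l1 (x - xs) / Real.sqrt s + C₁ * ε := by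
  have h2 : √2 ^ 2 = 2 := Real.sq_sqrt (by norm_num)
  obtain ⟨κ, hκ⟩ : ∃ κ, κ = 1 - δ - √2 * δ := ⟨_, rfl⟩
  have hκ0 : 0 < κ := by nlinarith [Real.sqrt_nonneg 2]
  refine ⟨4 * √2 * δ / κ + 2, 4 * √(1 + δ) / κ, by positivity, by positivity, ?_⟩
  rintro s hs m d A x xs xstar e ε - he hA ⟨T, hTcard, hxs, -⟩ ⟨hfeas, hmin⟩
  have hs0 : 0 < √(s : ℝ) := Real.sqrt_pos.2 (by exact_mod_cast hs)
  have hT : T.card ≤ s := hTcard.le.trans (min_le_left _ _)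
  have hl1 : l1 xstar ≤ l1 x := hmin x (by
    rw [sub_add_cancel_left]
    simpa [l2] using he)
  have hmeas : l2 (A.mulVec (xstar - x)) ≤ 2 * ε := by
    have h := l2_add_le (A.mulVec xstar - (A.mulVec x + e)) e
    rw [sub_add_eq_sub_sub, sub_add_cancel, ← Matrix.mulVec_sub] at h
    rw [sub_add_eq_sub_sub, ← Matrix.mulVec_sub] at hfeas
    linarith
  have hres : l1 (x - xs) = ∑ i ∈ Tᶜ, ‖x i‖ := by
    rw [l1, ← Finset.sum_add_sum_compl T, Finset.sum_eq_zero, zero_add]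
    · refine Finset.sum_congr rfl fun i hi => ?_
      simp [hxs, Finset.mem_compl.1 hi]
    · intro i hi
      simp [hxs, hi]
  have hcone := sum_compl_norm_le_of_l1_le hl1 T
  have hcs := sum_norm_le_sqrt_mul_l2 hT (xstar - x)
  obtain ⟨X, hX, hall, hhead⟩ := hA.exists_head_tail_bound hs hδ0 (xstar - x) hT
  set σ := (∑ i ∈ Tᶜ, ‖(xstar - x) i‖) / √s with hσ
  set η := l1 (x - xs) / √s with hη
  have hσle : σ ≤ X + 2 * η := by
    have hmul : √s * l2 (restrictTo T (xstar - x)) ≤ √s * X := by gcongr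
    rw [hσ, hη, div_le_iff₀ hs0, add_mul, mul_assoc, div_mul_cancel₀ _ hs0.ne', hres]
    linarith
  have hXle : κ * X ≤ 2 * √(1 + δ) * ε + 2 * √2 * δ * η := by
    have h3 := mul_le_mul_of_nonneg_left hmeas (Real.sqrt_nonneg (1 + δ))
    have h4 := mul_le_mul_of_nonneg_left hσle (by positivity : 0 ≤ √2 * δ)
    rw [hκ]
    linarith
  rw [mul_comm κ, ← le_div_iff₀ hκ0] at hXle
  calc l2 (xstar - x) ≤ 2 * X + 2 * η := by linarith
    _ ≤ 2 * ((2 * √(1 + δ) * ε + 2 * √2 * δ * η) / κ) + 2 * η := by gcongr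
    _ = _ := by
      rw [hη]
      ring
end

section
/- Let A, Φ ∈ ℂ^{m×d} with A ≠ 0, let s ≥ 1, and set ε^{(4s)} = ‖A − Φ‖^{(4s)}/‖A‖^{(4s)}. Suppose A satisfies the restricted isometry property with parameters (4s, δ_{4s}) where 0 ≤ δ_{4s} ≤ 1.1/(1 + ε^{(4s)})² − 1. Then Φ satisfies the restricted isometry property with parameters (4s, 0.1). -/
open scoped BigOperators

lemma l2_zero {n : ℕ} : l2 (0 : Fin n → ℂ) = 0 := by simp [l2_eq_norm]

lemma l2_eq_zero {n : ℕ} {x : Fin n → ℂ} : l2 x = 0 ↔ x = 0 := by simp [l2_eq_norm]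

lemma l2_smul {n : ℕ} (c : ℂ) (x : Fin n → ℂ) : l2 (c • x) = ‖c‖ * l2 x := by
  simp [l2_eq_norm, norm_smul]

lemma Sparse.smul {n s : ℕ} {x : Fin n → ℂ} (hx : Sparse s x) (c : ℂ) : Sparse s (c • x) := by
  obtain ⟨T, hT, h⟩ := hx
  exact ⟨T, hT, fun i hi => by simp [h i hi]⟩

lemma sparse_zero {n s : ℕ} : Sparse s (0 : Fin n → ℂ) :=
  ⟨∅, by simp, fun _ _ => rfl⟩

lemma sparse_single {n s : ℕ} (hs : 1 ≤ s) (j : Fin n) (c : ℂ) :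
    Sparse s (Pi.single j c : Fin n → ℂ) :=
  ⟨{j}, by simpa using hs, fun _ hi => Pi.single_eq_of_ne (Finset.notMem_singleton.1 hi) _⟩

lemma bddAbove_specNormS {m d : ℕ} (s : ℕ) (M : Matrix (Fin m) (Fin d) ℂ) :
    BddAbove {r | ∃ x : Fin d → ℂ, Sparse s x ∧ l2 x ≤ 1 ∧ r = l2 (M.mulVec x)} := by
  refine ⟨‖(Matrix.toEuclideanLin M).toContinuousLinearMap‖, ?_⟩
  rintro r ⟨x, -, hx, rfl⟩
  rw [l2_eq_norm] at hx
  have h := (Matrix.toEuclideanLin M).toContinuousLinearMap.le_opNorm (WithLp.toLp 2 x)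
  rw [l2_eq_norm]
  exact h.trans (mul_le_of_le_one_right (norm_nonneg _) hx)

lemma specNormS_nonneg {m d : ℕ} (s : ℕ) (M : Matrix (Fin m) (Fin d) ℂ) :
    0 ≤ specNormS s M :=
  le_csSup (bddAbove_specNormS s M)
    ⟨0, sparse_zero, by simp [l2_zero], by simp [l2_zero]⟩

lemma l2_mulVec_le {m d s : ℕ} (M : Matrix (Fin m) (Fin d) ℂ) {x : Fin d → ℂ}
    (hx : Sparse s x) : l2 (M.mulVec x) ≤ specNormS s M * l2 x := by
  rcases (l2_nonneg x).eq_or_lt with h0 | hpos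
  · simp [l2_eq_zero.1 h0.symm, l2_zero]
  have hn : ‖((l2 x : ℂ))⁻¹‖ = (l2 x)⁻¹ := by
    rw [norm_inv, Complex.norm_real, Real.norm_of_nonneg hpos.le]
  have h : (l2 x)⁻¹ * l2 (M.mulVec x) ≤ specNormS s M :=
    le_csSup (bddAbove_specNormS s M) ⟨((l2 x : ℂ))⁻¹ • x, hx.smul _,
      by rw [l2_smul, hn, inv_mul_cancel₀ hpos.ne'],
      by rw [Matrix.mulVec_smul, l2_smul, hn]⟩
  rwa [inv_mul_le_iff₀ hpos, mul_comm] at h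

lemma specNormS_pos {m d s : ℕ} (hs : 1 ≤ s) {M : Matrix (Fin m) (Fin d) ℂ} (hM : M ≠ 0) :
    0 < specNormS s M := by
  refine (specNormS_nonneg s M).lt_of_ne fun h => hM ?_
  ext i j
  have hle := l2_mulVec_le M (sparse_single hs j 1)
  rw [← h, zero_mul] at hle
  have h0 := l2_eq_zero.1 (hle.antisymm (l2_nonneg _))
  simpa using congrFun h0 i

lemma RIP.l2_mulVec_le {m d s : ℕ} {A : Matrix (Fin m) (Fin d) ℂ} {δ : ℝ} (hA : RIP A s δ)
    (hδ : 0 ≤ δ) {x : Fin d → ℂ} (hx : Sparse s x) :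
    l2 (A.mulVec x) ≤ Real.sqrt (1 + δ) * l2 x := by
  refine le_of_sq_le_sq ?_ (mul_nonneg (Real.sqrt_nonneg _) (l2_nonneg x))
  rw [mul_pow, Real.sq_sqrt (by linarith)]
  exact (hA x hx).2

lemma RIP.le_l2_mulVec {m d s : ℕ} {A : Matrix (Fin m) (Fin d) ℂ} {δ : ℝ} (hA : RIP A s δ)
    (hδ : δ ≤ 1) {x : Fin d → ℂ} (hx : Sparse s x) :
    Real.sqrt (1 - δ) * l2 x ≤ l2 (A.mulVec x) := by
  refine le_of_sq_le_sq ?_ (l2_nonneg _)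
  rw [mul_pow, Real.sq_sqrt (by linarith)]
  exact (hA x hx).1

lemma RIP.specNormS_le {m d s : ℕ} {A : Matrix (Fin m) (Fin d) ℂ} {δ : ℝ} (hA : RIP A s δ)
    (hδ : 0 ≤ δ) : specNormS s A ≤ Real.sqrt (1 + δ) := by
  refine csSup_le ⟨_, 0, sparse_zero, by simp [l2_zero], rfl⟩ ?_
  rintro r ⟨x, hx, hx1, rfl⟩
  exact (hA.l2_mulVec_le hδ hx).trans (mul_le_of_le_one_right (Real.sqrt_nonneg _) hx1)

lemma sqrt_one_sub_add_sqrt_one_add_anti {a b : ℝ} (ha : 0 ≤ a) (hab : a ≤ b) (hb : b ≤ 1) :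
    Real.sqrt (1 - b) + Real.sqrt (1 + b) ≤ Real.sqrt (1 - a) + Real.sqrt (1 + a) := by
  refine le_of_sq_le_sq ?_ (by positivity)
  have h : Real.sqrt (1 - b) * Real.sqrt (1 + b) ≤ Real.sqrt (1 - a) * Real.sqrt (1 + a) := by
    rw [← Real.sqrt_mul (by linarith), ← Real.sqrt_mul (by linarith)]
    exact Real.sqrt_le_sqrt (by nlinarith)
  rw [add_sq, add_sq, Real.sq_sqrt (by linarith), Real.sq_sqrt (by linarith),
    Real.sq_sqrt (by linarith), Real.sq_sqrt (by linarith)]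
  linarith

/-- If `δ_{4s} ≤ 1.1 / (1 + ε^{(4s)})² - 1` then the decoding matrix `Φ`
satisfies the RIP with parameters `(4s, 0.1)`. -/
theorem rip_perturbed_01 (m d s : ℕ) (hs : 1 ≤ s)
    (A Φ : Matrix (Fin m) (Fin d) ℂ) (hA : A ≠ 0)
    (δ : ℝ) (hδ0 : 0 ≤ δ)
    (hδ : δ ≤ 1.1 / (1 + specNormS (4 * s) (A - Φ) / specNormS (4 * s) A) ^ 2 - 1)
    (hRIP : RIP A (4 * s) δ) :
    RIP Φ (4 * s) 0.1 := by
  have ha : 0 < specNormS (4 * s) A := specNormS_pos (by omega) hA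
  have he : 0 ≤ specNormS (4 * s) (A - Φ) := specNormS_nonneg _ _
  have hau := hRIP.specNormS_le hδ0
  set a := specNormS (4 * s) A
  set e := specNormS (4 * s) (A - Φ)
  set ε := e / a with hε
  have hε0 : 0 ≤ ε := by positivity
  have hδ' : (1 + δ) * (1 + ε) ^ 2 ≤ 1.1 := by
    rw [← le_div_iff₀ (by positivity)]
    linarith
  have hδ1 : δ ≤ 0.1 := by nlinarith [mul_nonneg hδ0 hε0, mul_nonneg hδ0 (sq_nonneg ε)]
  have hup : Real.sqrt (1 + δ) + e ≤ Real.sqrt (1 + 0.1) := by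
    have h : e ≤ Real.sqrt (1 + δ) * ε := by
      calc e = a * ε := by rw [hε]; field_simp
        _ ≤ _ := by gcongr
    have h' : Real.sqrt (1 + δ) * (1 + ε) ≤ Real.sqrt (1 + 0.1) := by
      apply Real.le_sqrt_of_sq_le
      rw [mul_pow, Real.sq_sqrt (by linarith)]
      norm_num at hδ' ⊢
      exact hδ'
    linarith
  have hlow : Real.sqrt (1 - 0.1) ≤ Real.sqrt (1 - δ) - e := by
    linarith [sqrt_one_sub_add_sqrt_one_add_anti hδ0 hδ1 (by norm_num)]
  intro x hx
  have hE : l2 ((A - Φ).mulVec x) ≤ e * l2 x := l2_mulVec_le _ hx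
  have hA1 := hRIP.l2_mulVec_le hδ0 hx
  have hA2 := hRIP.le_l2_mulVec (by linarith) hx
  have hΦ1 : l2 (Φ.mulVec x) ≤ l2 (A.mulVec x) + l2 ((A - Φ).mulVec x) := by
    have h := l2_add_le (A.mulVec x) (-((A - Φ).mulVec x))
    rwa [l2_neg, Matrix.sub_mulVec, ← sub_eq_add_neg, sub_sub_cancel,
      ← Matrix.sub_mulVec] at h
  have hΦ2 : l2 (A.mulVec x) ≤ l2 (Φ.mulVec x) + l2 ((A - Φ).mulVec x) := by
    simpa [Matrix.sub_mulVec] using l2_add_le (Φ.mulVec x) ((A - Φ).mulVec x)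
  have hx0 := l2_nonneg x
  constructor
  · rw [← Real.sq_sqrt (show (0 : ℝ) ≤ 1 - 0.1 by norm_num), ← mul_pow]
    refine pow_le_pow_left₀ (by positivity) ?_ 2
    linarith [mul_le_mul_of_nonneg_right hlow hx0]
  · rw [← Real.sq_sqrt (show (0 : ℝ) ≤ 1 + 0.1 by norm_num), ← mul_pow]
    refine pow_le_pow_left₀ (l2_nonneg _) ?_ 2
    linarith [mul_le_mul_of_nonneg_right hup hx0]
end
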